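/- arXiv:2510.13335 — 2 statements merged into one kernel-verified Lean document; each statement's English description precedes it below -/
import Mathlib

section
/- Let k ≥ 1 be a natural number, let G be a 3-layer graph (V₁,V₂,V₃,E₁₂,E₂₃) regarded as a graph on V₁ ∪ V₂ ∪ V₃ with edge set E₁₂ ∪ E₂₃, and let σ be a 3-layer drawing of G with at most k crossings. Then for every vertex v of G, the number of connected components of G − v that contain both a neighbour of v and a vertex lying in the same part (V₁, V₂ or V₃) as v is at most 8·√k. -/
open Finset
open scoped Classical

/-- The number of crossings between edges of a single layer pair: every unordered
crossing pair of edges of `E` is counted exactly once. -/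
noncomputable def crossNum {A B : Type*} (E : Finset (A × B))
    (σ : A → ℝ) (τ : B → ℝ) : ℕ :=
  ((E ×ˢ E).filter (fun p => σ p.1.1 < σ p.2.1 ∧ τ p.2.2 < τ p.1.2)).card

/-- The 3-layer graph on `V₁ ⊕ V₂ ⊕ V₃` determined by the edge sets `E₁₂` and `E₂₃`. -/
def layerGraph3 {V₁ V₂ V₃ : Type*} (E₁₂ : Finset (V₁ × V₂)) (E₂₃ : Finset (V₂ × V₃)) :
    SimpleGraph (V₁ ⊕ V₂ ⊕ V₃) :=
  SimpleGraph.fromRel fun x y =>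
    (∃ e ∈ E₁₂, x = Sum.inl e.1 ∧ y = Sum.inr (Sum.inl e.2)) ∨
    (∃ e ∈ E₂₃, x = Sum.inr (Sum.inl e.1) ∧ y = Sum.inr (Sum.inr e.2))

/-- The index of the part containing a vertex. -/
def partIndex {V₁ V₂ V₃ : Type*} : V₁ ⊕ V₂ ⊕ V₃ → ℕ :=
  Sum.elim (fun _ => 1) (Sum.elim (fun _ => 2) fun _ => 3)

/-- Two edges of `E` cross in the drawing `(σ, τ)`. -/
def EdgesCross {A B : Type*} (E : Finset (A × B)) (σ : A → ℝ) (τ : B → ℝ) (e e' : A × B) : Prop :=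
  e ∈ E ∧ e' ∈ E ∧
    ((σ e.1 < σ e'.1 ∧ τ e'.2 < τ e.2) ∨ (σ e'.1 < σ e.1 ∧ τ e.2 < τ e'.2))

/-- If every two distinct elements of `S` are the two labels of an element of `X`, where `X` has at
most `k` elements, then `S` has at most `2√k` elements. -/
lemma card_le_two_mul_sqrt_of_label {ι L : Type*} (X : Finset ι) (f g : ι → L) (S : Finset L)
    (k : ℕ) (hk : 1 ≤ k) (hX : #X ≤ k)
    (h : ∀ l ∈ S, ∀ m ∈ S, l ≠ m → ∃ x ∈ X, (f x = l ∧ g x = m) ∨ (f x = m ∧ g x = l)) :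
    (#S : ℝ) ≤ 2 * √k := by
  have hsub : S.offDiag ⊆ X.image (fun x => (f x, g x)) ∪ X.image (fun x => (g x, f x)) := by
    rintro ⟨l, m⟩ hlm
    obtain ⟨hl, hm, hne⟩ := mem_offDiag.1 hlm
    obtain ⟨x, hx, ⟨rfl, rfl⟩ | ⟨rfl, rfl⟩⟩ := h l hl m hm hne
    · exact mem_union_left _ (mem_image_of_mem _ hx)
    · exact mem_union_right _ (mem_image_of_mem (fun x => (g x, f x)) hx)
  have hcard : #S * #S - #S ≤ k + k := by
    rw [← offDiag_card]
    exact (card_le_card hsub).trans ((card_union_le _ _).trans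
      (add_le_add (card_image_le.trans hX) (card_image_le.trans hX)))
  have hsq : #S * #S ≤ 4 * k := by
    rcases Nat.lt_or_ge (#S) 2 with h2 | h2
    · interval_cases #S <;> omega
    · have : 2 * #S ≤ #S * #S := Nat.mul_le_mul_right _ h2
      omega
  have hk0 : (0 : ℝ) ≤ k := Nat.cast_nonneg k
  have hsq' : (#S : ℝ) * #S ≤ 4 * k := by exact_mod_cast hsq
  refine abs_le_of_sq_le_sq' ?_ (by positivity) |>.2
  rw [mul_pow, Real.sq_sqrt hk0]
  linarith [sq (#S : ℝ)]

lemma card_le_two_mul_sqrt_of_edgesCross {A B C L : Type*} (E₁₂ : Finset (A × B))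
    (E₂₃ : Finset (B × C)) (σ₁ : A → ℝ) (σ₂ : B → ℝ) (σ₃ : C → ℝ) (f : A × B → L) (g : B × C → L)
    (S : Finset L) (k : ℕ) (hk : 1 ≤ k) (hcr : crossNum E₁₂ σ₁ σ₂ + crossNum E₂₃ σ₂ σ₃ ≤ k)
    (h : ∀ l ∈ S, ∀ m ∈ S, l ≠ m →
      (∃ e e', EdgesCross E₁₂ σ₁ σ₂ e e' ∧ f e = l ∧ f e' = m) ∨
      (∃ e e', EdgesCross E₂₃ σ₂ σ₃ e e' ∧ g e = l ∧ g e' = m)) :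
    (#S : ℝ) ≤ 2 * √k := by
  unfold crossNum at hcr
  rw [← card_disjSum] at hcr
  refine card_le_two_mul_sqrt_of_label _ (Sum.elim (fun p => f p.1) (fun p => g p.1))
    (Sum.elim (fun p => f p.2) (fun p => g p.2)) S k hk hcr fun l hl m hm hne => ?_
  rcases h l hl m hm hne with ⟨e, e', ⟨he, he', hc | hc⟩, hl, hm⟩ |
    ⟨e, e', ⟨he, he', hc | hc⟩, hl, hm⟩
  · exact ⟨Sum.inl (e, e'), by simp [he, he', hc], by simp [hl, hm]⟩
  · exact ⟨Sum.inl (e', e), by simp [he, he', hc], by simp [hl, hm]⟩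
  · exact ⟨Sum.inr (e, e'), by simp [he, he', hc], by simp [hl, hm]⟩
  · exact ⟨Sum.inr (e', e), by simp [he, he', hc], by simp [hl, hm]⟩

lemma card_le_four_mul_of_cover {L : Type*} (S : Finset L) (p : Bool → Bool → L → Prop) (b : ℝ)
    (hcover : ∀ l ∈ S, ∃ i j, p i j l)
    (hb : ∀ i j (T : Finset L), (∀ l ∈ T, p i j l) → (#T : ℝ) ≤ b) :
    (#S : ℝ) ≤ 4 * b := by
  have hsub : S ⊆ univ.biUnion fun q : Bool × Bool => S.filter (p q.1 q.2) := by
    intro l hl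
    obtain ⟨i, j, hij⟩ := hcover l hl
    exact mem_biUnion.2 ⟨(i, j), mem_univ _, mem_filter.2 ⟨hl, hij⟩⟩
  have hcard := (card_le_card hsub).trans card_biUnion_le
  have hcard' : (#S : ℝ) ≤ ∑ q : Bool × Bool, (#(S.filter (p q.1 q.2)) : ℝ) := by
    exact_mod_cast hcard
  refine hcard'.trans ((sum_le_card_nsmul _ _ b fun q _ =>
    hb q.1 q.2 _ fun _ hl => (mem_filter.1 hl).2).trans ?_)
  simp

/-- `v` lies in the middle layer, and every label in `S` is carried by a neighbour of `v` that has
a second neighbour in the middle layer. -/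
lemma card_le_of_middle {A B C L : Type*} (E₁₂ : Finset (A × B)) (E₂₃ : Finset (B × C))
    (σ₁ : A → ℝ) (σ₂ : B → ℝ) (σ₃ : C → ℝ) (hσ₁ : Function.Injective σ₁)
    (hσ₂ : Function.Injective σ₂) (hσ₃ : Function.Injective σ₃) (k : ℕ) (hk : 1 ≤ k)
    (hcr : crossNum E₁₂ σ₁ σ₂ + crossNum E₂₃ σ₂ σ₃ ≤ k) (v : B) (f : A → L) (g : C → L)
    (S : Finset L)
    (hS : ∀ l ∈ S, (∃ x y, (x, v) ∈ E₁₂ ∧ (x, y) ∈ E₁₂ ∧ y ≠ v ∧ f x = l) ∨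
      (∃ x y, (v, x) ∈ E₂₃ ∧ (y, x) ∈ E₂₃ ∧ y ≠ v ∧ g x = l)) :
    (#S : ℝ) ≤ 8 * √k := by
  let side : Bool → B → Prop := fun i y => if i then σ₂ y < σ₂ v else σ₂ v < σ₂ y
  have hside : ∀ y, y ≠ v → ∃ i, side i y := fun y hy => by
    rcases lt_or_gt_of_ne (hσ₂.ne hy) with h | h
    · exact ⟨true, by simpa [side] using h⟩
    · exact ⟨false, by simpa [side] using h⟩
  let p : Bool → Bool → L → Prop := fun i j l =>
    if j then ∃ x y, (x, v) ∈ E₁₂ ∧ (x, y) ∈ E₁₂ ∧ side i y ∧ f x = l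
    else ∃ x y, (v, x) ∈ E₂₃ ∧ (y, x) ∈ E₂₃ ∧ side i y ∧ g x = l
  have key := card_le_four_mul_of_cover S p (2 * √k) ?_ ?_
  · linarith
  · intro l hl
    rcases hS l hl with ⟨x, y, h₁, h₂, hne, hx⟩ | ⟨x, y, h₁, h₂, hne, hx⟩
    · obtain ⟨i, hi⟩ := hside y hne
      exact ⟨i, true, by simpa [p] using ⟨x, h₁, y, h₂, hi, hx⟩⟩
    · obtain ⟨i, hi⟩ := hside y hne
      exact ⟨i, false, by simpa [p] using ⟨x, h₁, y, h₂, hi, hx⟩⟩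
  · intro i j T hT
    refine card_le_two_mul_sqrt_of_edgesCross E₁₂ E₂₃ σ₁ σ₂ σ₃ (fun e => f e.1) (fun e => g e.2)
      _ k hk hcr fun l hl m hm hne => ?_
    replace hl := hT l hl
    replace hm := hT m hm
    cases j
    · obtain ⟨x, y, h₁, h₂, hi, rfl⟩ : ∃ x y, (v, x) ∈ E₂₃ ∧ (y, x) ∈ E₂₃ ∧ side i y ∧ g x = l := by
        simpa [p] using hl
      obtain ⟨x', y', h₁', h₂', hi', rfl⟩ :
          ∃ x y, (v, x) ∈ E₂₃ ∧ (y, x) ∈ E₂₃ ∧ side i y ∧ g x = m := by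
        simpa [p] using hm
      right
      have hx : σ₃ x ≠ σ₃ x' := hσ₃.ne fun h => hne (by rw [h])
      rcases lt_or_gt_of_ne hx with hx | hx <;> cases i <;> simp [side] at hi hi'
      · exact ⟨(y, x), (v, x'), ⟨h₂, h₁', by simp; grind⟩, rfl, rfl⟩
      · exact ⟨(v, x), (y', x'), ⟨h₁, h₂', by simp; grind⟩, rfl, rfl⟩
      · exact ⟨(v, x), (y', x'), ⟨h₁, h₂', by simp; grind⟩, rfl, rfl⟩
      · exact ⟨(y, x), (v, x'), ⟨h₂, h₁', by simp; grind⟩, rfl, rfl⟩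
    · obtain ⟨x, y, h₁, h₂, hi, rfl⟩ : ∃ x y, (x, v) ∈ E₁₂ ∧ (x, y) ∈ E₁₂ ∧ side i y ∧ f x = l := by
        simpa [p] using hl
      obtain ⟨x', y', h₁', h₂', hi', rfl⟩ :
          ∃ x y, (x, v) ∈ E₁₂ ∧ (x, y) ∈ E₁₂ ∧ side i y ∧ f x = m := by
        simpa [p] using hm
      left
      have hx : σ₁ x ≠ σ₁ x' := hσ₁.ne fun h => hne (by rw [h])
      rcases lt_or_gt_of_ne hx with hx | hx <;> cases i <;> simp [side] at hi hi'
      · exact ⟨(x, y), (x', v), ⟨h₂, h₁', by simp; grind⟩, rfl, rfl⟩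
      · exact ⟨(x, v), (x', y'), ⟨h₁, h₂', by simp; grind⟩, rfl, rfl⟩
      · exact ⟨(x, v), (x', y'), ⟨h₁, h₂', by simp; grind⟩, rfl, rfl⟩
      · exact ⟨(x, y), (x', v), ⟨h₂, h₁', by simp; grind⟩, rfl, rfl⟩

/-- Two vertices of the first layer have a common neighbour in the second. -/
def CommonNbr {B C : Type*} (E : Finset (B × C)) (b b' : B) : Prop :=
  ∃ c, (b, c) ∈ E ∧ (b', c) ∈ E

lemma label_eq_of_reflTransGen {B C L : Type*} {E : Finset (B × C)} {f : B → L}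
    (hf : ∀ b b', CommonNbr E b b' → f b = f b') {b b' : B}
    (h : Relation.ReflTransGen (CommonNbr E) b b') : f b = f b' := by
  induction h with
  | refl => rfl
  | tail _ hs ih => exact ih.trans (hf _ _ hs)

/-- If the edge `(a, z)` crosses no edge with label `m`, then a path with label `m` stays on one
side of it. -/
lemma lt_iff_lt_of_reflTransGen {B C L : Type*} {E : Finset (B × C)} {f : B → L}
    (hf : ∀ b b', CommonNbr E b b' → f b = f b') {σ : B → ℝ} {τ : C → ℝ} {a : B} {z : C} {m : L}
    (hlt : ∀ p q, (p, q) ∈ E → f p = m → (σ a < σ p ↔ τ z < τ q)) {b b' : B} (hb : f b = m)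
    (h : Relation.ReflTransGen (CommonNbr E) b b') : σ a < σ b ↔ σ a < σ b' := by
  induction h with
  | refl => rfl
  | @tail c d hc hs ih =>
    have hcm : f c = m := (label_eq_of_reflTransGen hf hc).symm.trans hb
    have hdm : f d = m := (hf _ _ hs).symm.trans hcm
    obtain ⟨u, hcu, hdu⟩ := hs
    rw [ih, hlt c u hcu hcm, hlt d u hdu hdm]

/-- `v` lies in the first layer, and every label in `S` is carried by a path through the last two
layers from a neighbour of `v` to a neighbour of another vertex of the first layer. -/
lemma card_le_of_end {A B C L : Type*} (E₁₂ : Finset (A × B)) (E₂₃ : Finset (B × C))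
    (σ₁ : A → ℝ) (σ₂ : B → ℝ) (σ₃ : C → ℝ) (hσ₁ : Function.Injective σ₁)
    (hσ₂ : Function.Injective σ₂) (hσ₃ : Function.Injective σ₃) (k : ℕ) (hk : 1 ≤ k)
    (hcr : crossNum E₁₂ σ₁ σ₂ + crossNum E₂₃ σ₂ σ₃ ≤ k) (v : A) (f : B → L)
    (hf : ∀ b b', CommonNbr E₂₃ b b' → f b = f b') (S : Finset L)
    (hS : ∀ l ∈ S, ∃ x y w, (v, x) ∈ E₁₂ ∧ (w, y) ∈ E₁₂ ∧ w ≠ v ∧ f x = l ∧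
      Relation.ReflTransGen (CommonNbr E₂₃) x y) :
    (#S : ℝ) ≤ 8 * √k := by
  let side : Bool → A → Prop := fun i w => if i then σ₁ w < σ₁ v else σ₁ v < σ₁ w
  have hside : ∀ w, w ≠ v → ∃ i, side i w := fun w hw => by
    rcases lt_or_gt_of_ne (hσ₁.ne hw) with h | h
    · exact ⟨true, by simpa [side] using h⟩
    · exact ⟨false, by simpa [side] using h⟩
  let p : Bool → Bool → L → Prop := fun i j l =>
    ∃ x y w, (v, x) ∈ E₁₂ ∧ (w, y) ∈ E₁₂ ∧ side i w ∧ f x = l ∧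
      Relation.ReflTransGen (CommonNbr E₂₃) x y ∧ if j then x = y else ∃ z, (x, z) ∈ E₂₃
  have key := card_le_four_mul_of_cover S p (2 * √k) ?_ ?_
  · linarith
  · intro l hl
    obtain ⟨x, y, w, hx, hy, hw, hl, hxy⟩ := hS l hl
    obtain ⟨i, hi⟩ := hside w hw
    rcases hxy.cases_head with h | ⟨c, ⟨z, hz, -⟩, -⟩
    · exact ⟨i, true, x, y, w, hx, hy, hi, hl, hxy, by simpa using h⟩
    · exact ⟨i, false, x, y, w, hx, hy, hi, hl, hxy, by simpa using ⟨z, hz⟩⟩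
  · intro i j T hT
    refine card_le_two_mul_sqrt_of_edgesCross E₁₂ E₂₃ σ₁ σ₂ σ₃ (fun e => f e.2) (fun e => f e.1)
      _ k hk hcr fun l hl m hm hne => ?_
    obtain ⟨x, y, w, hx, hy, hi, rfl, hxy, hj⟩ := hT l hl
    obtain ⟨x', y', w', hx', hy', hi', rfl, hxy', hj'⟩ := hT m hm
    have hfy := label_eq_of_reflTransGen hf hxy
    have hfy' := label_eq_of_reflTransGen hf hxy'
    by_cases hno : ∃ e e', EdgesCross E₂₃ σ₂ σ₃ e e' ∧ f e.1 = f x ∧ f e'.1 = f x'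
    · exact Or.inr hno
    left
    have hxx : σ₂ x ≠ σ₂ x' := hσ₂.ne fun h => hne (by rw [h])
    have hxy₁ : σ₂ x ≠ σ₂ y' := hσ₂.ne fun h => hne (by rw [hfy', h])
    have hxy₂ : σ₂ x' ≠ σ₂ y := hσ₂.ne fun h => hne (by rw [hfy, h])
    have hsep : (σ₂ x < σ₂ x' ↔ σ₂ x < σ₂ y') ∧ (σ₂ x' < σ₂ x ↔ σ₂ x' < σ₂ y) := by
      cases j
      · obtain ⟨z, hz⟩ : ∃ z, (x, z) ∈ E₂₃ := by simpa using hj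
        obtain ⟨z', hz'⟩ : ∃ z, (x', z) ∈ E₂₃ := by simpa using hj'
        have hlt : ∀ a b c d, (a, b) ∈ E₂₃ → (c, d) ∈ E₂₃ → f a = f x → f c = f x' →
            ((σ₂ a < σ₂ c ↔ σ₃ b < σ₃ d) ∧ (σ₂ c < σ₂ a ↔ σ₃ d < σ₃ b)) := by
          intro a b c d hab hcd ha hc
          have h₁ : σ₂ a ≠ σ₂ c := hσ₂.ne fun h => hne (by rw [← ha, ← hc, h])
          have h₂ : σ₃ b ≠ σ₃ d := hσ₃.ne fun h => hne (by
            rw [← ha, ← hc]; exact hf _ _ ⟨b, hab, h ▸ hcd⟩)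
          have h₃ : ¬ EdgesCross E₂₃ σ₂ σ₃ (a, b) (c, d) := fun h => hno ⟨_, _, h, ha, hc⟩
          simp only [EdgesCross, hab, hcd, true_and] at h₃
          grind
        exact ⟨lt_iff_lt_of_reflTransGen hf
            (fun p q hpq hp => (hlt x z p q hz hpq rfl hp).1) rfl hxy',
          lt_iff_lt_of_reflTransGen hf
            (fun p q hpq hp => (hlt p q x' z' hpq hz' hp rfl).2) rfl hxy⟩
      · obtain rfl : x = y := by simpa using hj
        obtain rfl : x' = y' := by simpa using hj'
        exact ⟨Iff.rfl, Iff.rfl⟩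
    rcases lt_or_gt_of_ne hxx with h | h <;> cases i <;> simp [side] at hi hi'
    · exact ⟨(w, y), (v, x'), ⟨hy, hx', by simp; grind⟩, hfy.symm, rfl⟩
    · exact ⟨(v, x), (w', y'), ⟨hx, hy', by simp; grind⟩, rfl, hfy'.symm⟩
    · exact ⟨(v, x), (w', y'), ⟨hx, hy', by simp; grind⟩, rfl, hfy'.symm⟩
    · exact ⟨(w, y), (v, x'), ⟨hy, hx', by simp; grind⟩, hfy.symm, rfl⟩

lemma crossNum_map_prodComm {A B : Type*} (E : Finset (A × B)) (σ : A → ℝ) (τ : B → ℝ) :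
    crossNum (E.map (Equiv.prodComm A B).toEmbedding) τ σ = crossNum E σ τ := by
  unfold crossNum
  refine card_bij' (fun p _ => (p.2.swap, p.1.swap)) (fun p _ => (p.2.swap, p.1.swap)) ?_ ?_ ?_ ?_
  · rintro ⟨⟨a, b⟩, c, d⟩ h
    simp at h ⊢
    tauto
  · rintro ⟨⟨a, b⟩, c, d⟩ h
    simp at h ⊢
    tauto
  · simp
  · simp

/-- The connected component of `x` in `layerGraph3 E₁₂ E₂₃ - v`. -/
abbrev compMk {V₁ V₂ V₃ : Type*} (E₁₂ : Finset (V₁ × V₂)) (E₂₃ : Finset (V₂ × V₃))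
    (v x : V₁ ⊕ V₂ ⊕ V₃) (hx : x ≠ v) :
    ((layerGraph3 E₁₂ E₂₃).induce {w | w ≠ v}).ConnectedComponent :=
  ((layerGraph3 E₁₂ E₂₃).induce {w | w ≠ v}).connectedComponentMk ⟨x, hx⟩

section Layers

variable {V₁ V₂ V₃ : Type*} {E₁₂ : Finset (V₁ × V₂)} {E₂₃ : Finset (V₂ × V₃)}

lemma layerGraph3_adj_inl {a : V₁} {x : V₁ ⊕ V₂ ⊕ V₃} :
    (layerGraph3 E₁₂ E₂₃).Adj (Sum.inl a) x ↔ ∃ b, x = Sum.inr (Sum.inl b) ∧ (a, b) ∈ E₁₂ := by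
  rcases x with x | x | x <;> simp [layerGraph3]

lemma layerGraph3_adj_mid {b : V₂} {x : V₁ ⊕ V₂ ⊕ V₃} :
    (layerGraph3 E₁₂ E₂₃).Adj (Sum.inr (Sum.inl b)) x ↔
      (∃ a, x = Sum.inl a ∧ (a, b) ∈ E₁₂) ∨ ∃ c, x = Sum.inr (Sum.inr c) ∧ (b, c) ∈ E₂₃ := by
  rcases x with x | x | x <;> simp [layerGraph3]

lemma layerGraph3_adj_inr {c : V₃} {x : V₁ ⊕ V₂ ⊕ V₃} :
    (layerGraph3 E₁₂ E₂₃).Adj (Sum.inr (Sum.inr c)) x ↔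
      ∃ b, x = Sum.inr (Sum.inl b) ∧ (b, c) ∈ E₂₃ := by
  rcases x with x | x | x <;> simp [layerGraph3]

lemma compMk_eq_of_adj {v x y : V₁ ⊕ V₂ ⊕ V₃} (hx : x ≠ v) (hy : y ≠ v)
    (h : (layerGraph3 E₁₂ E₂₃).Adj x y) : compMk E₁₂ E₂₃ v x hx = compMk E₁₂ E₂₃ v y hy :=
  SimpleGraph.ConnectedComponent.sound (SimpleGraph.Adj.reachable (by simpa using h))

/-- A property closed under adjacency in `G - v` propagates within a component. -/
lemma of_compMk_eq {v x y : V₁ ⊕ V₂ ⊕ V₃} {hx : x ≠ v} {hy : y ≠ v}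
    (h : compMk E₁₂ E₂₃ v x hx = compMk E₁₂ E₂₃ v y hy) {P : V₁ ⊕ V₂ ⊕ V₃ → Prop}
    (hP : ∀ a b, a ≠ v → b ≠ v → (layerGraph3 E₁₂ E₂₃).Adj a b → P a → P b) (hPx : P x) : P y := by
  obtain ⟨p⟩ := SimpleGraph.ConnectedComponent.exact h
  have key : ∀ {a b : {w : V₁ ⊕ V₂ ⊕ V₃ | w ≠ v}},
      ((layerGraph3 E₁₂ E₂₃).induce {w | w ≠ v}).Walk a b → P a → P b := by
    intro a b q
    induction q with
    | nil => exact id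
    | @cons a b c hab _ ih => exact fun ha => ih (hP a b a.2 b.2 (by simpa using hab) ha)
  exact key p hPx

/-- A vertex whose component in `G - v` has another vertex has a neighbour in `G - v`. -/
lemma exists_adj_of_compMk_eq {v x y : V₁ ⊕ V₂ ⊕ V₃} {hx : x ≠ v} {hy : y ≠ v}
    (h : compMk E₁₂ E₂₃ v x hx = compMk E₁₂ E₂₃ v y hy) (hxy : x ≠ y) :
    ∃ z, z ≠ v ∧ (layerGraph3 E₁₂ E₂₃).Adj x z := by
  by_contra hno
  push Not at hno
  exact hxy (of_compMk_eq h (P := fun z => x = z)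
    (by rintro a b - hb hab rfl; exact absurd hab (hno b hb)) rfl)

lemma exists_path_to_first {v : V₁ ⊕ V₂ ⊕ V₃} {x : V₂} {a : V₁} {hx : Sum.inr (Sum.inl x) ≠ v}
    {ha : Sum.inl a ≠ v}
    (h : compMk E₁₂ E₂₃ v (Sum.inr (Sum.inl x)) hx = compMk E₁₂ E₂₃ v (Sum.inl a) ha) :
    ∃ y w, (w, y) ∈ E₁₂ ∧ Sum.inl w ≠ v ∧ Relation.ReflTransGen (CommonNbr E₂₃) x y := by
  by_contra hno
  push Not at hno
  refine of_compMk_eq h (P := Sum.elim (fun _ => False) (Sum.elim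
    (Relation.ReflTransGen (CommonNbr E₂₃) x)
    (fun c => ∃ b, Relation.ReflTransGen (CommonNbr E₂₃) x b ∧ (b, c) ∈ E₂₃))) ?_ .refl
  rintro (a | b | c) d - hd hadj hP
  · exact hP.elim
  · rcases layerGraph3_adj_mid.1 hadj with ⟨a, rfl, hab⟩ | ⟨c, rfl, hbc⟩
    · exact hno b a hab hd hP
    · exact ⟨b, hP, hbc⟩
  · obtain ⟨b, rfl, hbc⟩ := layerGraph3_adj_inr.1 hadj
    obtain ⟨b', hb', hbc'⟩ := hP
    exact hb'.tail ⟨c, hbc', hbc⟩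

lemma exists_path_to_last {v : V₁ ⊕ V₂ ⊕ V₃} {x : V₂} {c : V₃} {hx : Sum.inr (Sum.inl x) ≠ v}
    {hc : Sum.inr (Sum.inr c) ≠ v}
    (h : compMk E₁₂ E₂₃ v (Sum.inr (Sum.inl x)) hx = compMk E₁₂ E₂₃ v (Sum.inr (Sum.inr c)) hc) :
    ∃ y w, (y, w) ∈ E₂₃ ∧ Sum.inr (Sum.inr w) ≠ v ∧
      Relation.ReflTransGen (CommonNbr (E₁₂.map (Equiv.prodComm V₁ V₂).toEmbedding)) x y := by
  by_contra hno
  push Not at hno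
  let R := CommonNbr (E₁₂.map (Equiv.prodComm V₁ V₂).toEmbedding)
  refine of_compMk_eq h (P := Sum.elim
    (fun a => ∃ b, Relation.ReflTransGen R x b ∧ (a, b) ∈ E₁₂) (Sum.elim
    (Relation.ReflTransGen R x) (fun _ => False))) ?_ .refl
  rintro (a | b | c) d - hd hadj hP
  · obtain ⟨b, rfl, hab⟩ := layerGraph3_adj_inl.1 hadj
    obtain ⟨b', hb', hab'⟩ := hP
    exact hb'.tail ⟨a, by simpa using hab', by simpa using hab⟩
  · rcases layerGraph3_adj_mid.1 hadj with ⟨a, rfl, hab⟩ | ⟨c, rfl, hbc⟩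
    · exact ⟨b, hP, hab⟩
    · exact hno b c hbc hd hP
  · exact hP.elim

end Layers

/-- In a 3-layer drawing with at most `k` crossings, for every vertex `v`, the number of
connected components of `G - v` containing both a neighbour of `v` and a vertex in the
same part as `v` is at most `8√k`. -/
theorem updown_components_bound_three_layers {V₁ V₂ V₃ : Type*}
    [Fintype V₁] [Fintype V₂] [Fintype V₃]
    [DecidableEq V₁] [DecidableEq V₂] [DecidableEq V₃]
    (E₁₂ : Finset (V₁ × V₂)) (E₂₃ : Finset (V₂ × V₃)) (k : ℕ) (hk : 1 ≤ k)
    (σ₁ : V₁ → ℝ) (σ₂ : V₂ → ℝ) (σ₃ : V₃ → ℝ)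
    (hσ₁ : Function.Injective σ₁) (hσ₂ : Function.Injective σ₂)
    (hσ₃ : Function.Injective σ₃)
    (hcr : crossNum E₁₂ σ₁ σ₂ + crossNum E₂₃ σ₂ σ₃ ≤ k) (v : V₁ ⊕ V₂ ⊕ V₃) :
    (Set.ncard {c : ((layerGraph3 E₁₂ E₂₃).induce {w | w ≠ v}).ConnectedComponent |
        (∃ x, ∃ hx : x ≠ v, (layerGraph3 E₁₂ E₂₃).Adj v x ∧
          ((layerGraph3 E₁₂ E₂₃).induce {w | w ≠ v}).connectedComponentMk ⟨x, hx⟩ = c) ∧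
        (∃ x, ∃ hx : x ≠ v, partIndex x = partIndex v ∧
          ((layerGraph3 E₁₂ E₂₃).induce {w | w ≠ v}).connectedComponentMk ⟨x, hx⟩ = c)} : ℝ)
      ≤ 8 * Real.sqrt k := by
  rw [Set.ncard_eq_toFinset_card _ (Set.toFinite _)]
  rcases v with v | v | v
  · refine card_le_of_end E₁₂ E₂₃ σ₁ σ₂ σ₃ hσ₁ hσ₂ hσ₃ k hk hcr v
      (fun b => compMk E₁₂ E₂₃ _ (Sum.inr (Sum.inl b)) (by simp)) ?_ _ fun l hl => ?_
    · rintro b b' ⟨c, hb, hb'⟩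
      exact (compMk_eq_of_adj (y := Sum.inr (Sum.inr c)) _ (by simp)
        (layerGraph3_adj_mid.2 (Or.inr ⟨c, rfl, hb⟩))).trans
        (compMk_eq_of_adj _ _ (layerGraph3_adj_inr.2 ⟨b', rfl, hb'⟩))
    · obtain ⟨⟨x, hx, hadj, hxl⟩, u, hu, hpart, hul⟩ := (Set.Finite.mem_toFinset _).1 hl
      obtain ⟨b, rfl, hb⟩ := layerGraph3_adj_inl.1 hadj
      rcases u with a | u | u <;> simp [partIndex] at hpart
      obtain ⟨y, w, hwy, hw, hby⟩ := exists_path_to_first (hxl.trans hul.symm)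
      exact ⟨b, y, w, hb, hwy, by simpa using hw, hxl, hby⟩
  · refine card_le_of_middle E₁₂ E₂₃ σ₁ σ₂ σ₃ hσ₁ hσ₂ hσ₃ k hk hcr v
      (fun a => compMk E₁₂ E₂₃ _ (Sum.inl a) (by simp))
      (fun c => compMk E₁₂ E₂₃ _ (Sum.inr (Sum.inr c)) (by simp)) _ fun l hl => ?_
    obtain ⟨⟨x, hx, hadj, hxl⟩, u, hu, hpart, hul⟩ := (Set.Finite.mem_toFinset _).1 hl
    rcases u with u | u | u <;> simp [partIndex] at hpart
    rcases layerGraph3_adj_mid.1 hadj with ⟨a, rfl, ha⟩ | ⟨c, rfl, hc⟩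
    · obtain ⟨z, hz, hadj'⟩ := exists_adj_of_compMk_eq (hxl.trans hul.symm) (by simp)
      obtain ⟨b, rfl, hb⟩ := layerGraph3_adj_inl.1 hadj'
      exact Or.inl ⟨a, b, ha, hb, by simpa using hz, hxl⟩
    · obtain ⟨z, hz, hadj'⟩ := exists_adj_of_compMk_eq (hxl.trans hul.symm) (by simp)
      obtain ⟨b, rfl, hb⟩ := layerGraph3_adj_inr.1 hadj'
      exact Or.inr ⟨c, b, hc, hb, by simpa using hz, hxl⟩
  · rw [add_comm, ← crossNum_map_prodComm E₁₂, ← crossNum_map_prodComm E₂₃] at hcr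
    refine card_le_of_end _ _ σ₃ σ₂ σ₁ hσ₃ hσ₂ hσ₁ k hk hcr v
      (fun b => compMk E₁₂ E₂₃ _ (Sum.inr (Sum.inl b)) (by simp)) ?_ _ fun l hl => ?_
    · rintro b b' ⟨a, hb, hb'⟩
      exact (compMk_eq_of_adj (y := Sum.inl a) _ (by simp)
        (layerGraph3_adj_mid.2 (Or.inl ⟨a, rfl, by simpa using hb⟩))).trans
        (compMk_eq_of_adj _ _ (layerGraph3_adj_inl.2 ⟨b', rfl, by simpa using hb'⟩))
    · obtain ⟨⟨x, hx, hadj, hxl⟩, u, hu, hpart, hul⟩ := (Set.Finite.mem_toFinset _).1 hl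
      obtain ⟨b, rfl, hb⟩ := layerGraph3_adj_inr.1 hadj
      rcases u with u | u | c <;> simp [partIndex] at hpart
      obtain ⟨y, w, hwy, hw, hby⟩ := exists_path_to_last (hxl.trans hul.symm)
      exact ⟨b, y, w, by simpa using hb, by simpa using hwy, by simpa using hw, hxl, hby⟩
end

section
/- Let k ≥ 1 be a natural number and let σ = (σ₁,σ₂,σ₃) be a 3-layer drawing of a 3-layer graph (V₁,V₂,V₃,E₁₂,E₂₃) with at most k crossings. Let r ∈ V₂ and suppose there is an edge e₀ ∈ E₂₃ whose V₂-endpoint w₀ satisfies σ₂(w₀) ≥ σ₂(r) and which is crossed by at most √k edges. Then there exists an edge (y,z) ∈ E₂₃ with σ₂(y) ≥ σ₂(r) such that (y,z) is crossed by at most √k edges and the set of vertices w ∈ V₂ that have at least one neighbour in V₃ and satisfy σ₂(r) ≤ σ₂(w) < σ₂(y) has at most 2·√k elements. -/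
open Finset
open scoped Classical

/-- Two edges of a layer pair cross in the drawing `(σ, τ)`. -/
def Cross2 {A B : Type*} (σ : A → ℝ) (τ : B → ℝ) (e f : A × B) : Prop :=
  (σ e.1 < σ f.1 ∧ τ f.2 < τ e.2) ∨ (σ f.1 < σ e.1 ∧ τ e.2 < τ f.2)

/-- Summing over all edges the number of edges crossing them counts each crossing at most twice. -/
theorem sum_card_filter_cross2_le {A B : Type*} (E : Finset (A × B)) (σ : A → ℝ) (τ : B → ℝ) :
    ∑ e ∈ E, (E.filter (fun f => Cross2 σ τ e f)).card ≤ 2 * crossNum E σ τ := by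
  have hsum : ∑ e ∈ E, (E.filter (fun f => Cross2 σ τ e f)).card
      = ((E ×ˢ E).filter (fun p => Cross2 σ τ p.1 p.2)).card := by
    simp only [Finset.card_filter, Finset.sum_product]
  have hswap : ((E ×ˢ E).filter (fun p => σ p.2.1 < σ p.1.1 ∧ τ p.1.2 < τ p.2.2)).card
      ≤ crossNum E σ τ := by
    refine Finset.card_le_card_of_injOn Prod.swap ?_ Prod.swap_injective.injOn
    intro p hp
    simp only [Finset.coe_filter, Finset.mem_product, Set.mem_ofPred_eq, Prod.fst_swap,
      Prod.snd_swap] at hp ⊢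
    exact ⟨⟨hp.1.2, hp.1.1⟩, hp.2⟩
  rw [hsum, two_mul]
  calc ((E ×ˢ E).filter (fun p => Cross2 σ τ p.1 p.2)).card
      ≤ ((E ×ˢ E).filter (fun p => σ p.1.1 < σ p.2.1 ∧ τ p.2.2 < τ p.1.2) ∪
          (E ×ˢ E).filter (fun p => σ p.2.1 < σ p.1.1 ∧ τ p.1.2 < τ p.2.2)).card := by
        refine Finset.card_le_card fun p hp => ?_
        rw [Finset.mem_union, Finset.mem_filter, Finset.mem_filter, ← and_or_left]
        exact Finset.mem_filter.1 hp
    _ ≤ crossNum E σ τ + crossNum E σ τ :=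
        (Finset.card_union_le _ _).trans (Nat.add_le_add le_rfl hswap)

/-- In a 3-layer drawing with at most `k` crossings, if some edge of `E₂₃` with
`V₂`-endpoint to the right of `r` is crossed at most `√k` times, then there is such an
edge `(y, z)` for which at most `2√k` vertices of `V₂` with a neighbour in `V₃`
lie in the gap between `r` and `y`. -/
theorem exists_blue_edge_with_small_gap {V₁ V₂ V₃ : Type*}
    [Fintype V₁] [Fintype V₂] [Fintype V₃]
    [DecidableEq V₂] [DecidableEq V₃]
    (E₁₂ : Finset (V₁ × V₂)) (E₂₃ : Finset (V₂ × V₃))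
    (σ₁ : V₁ → ℝ) (σ₂ : V₂ → ℝ) (σ₃ : V₃ → ℝ)
    (hσ₁ : Function.Injective σ₁) (hσ₂ : Function.Injective σ₂)
    (hσ₃ : Function.Injective σ₃)
    (k : ℕ) (hk : 1 ≤ k)
    (hcr : crossNum E₁₂ σ₁ σ₂ + crossNum E₂₃ σ₂ σ₃ ≤ k)
    (r : V₂) (e₀ : V₂ × V₃) (he₀ : e₀ ∈ E₂₃) (hre₀ : σ₂ r ≤ σ₂ e₀.1)
    (hblue₀ : ((E₂₃.filter (fun f => Cross2 σ₂ σ₃ e₀ f)).card : ℝ) ≤ Real.sqrt k) :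
    ∃ g ∈ E₂₃, σ₂ r ≤ σ₂ g.1 ∧
      ((E₂₃.filter (fun f => Cross2 σ₂ σ₃ g f)).card : ℝ) ≤ Real.sqrt k ∧
      (((Finset.univ : Finset V₂).filter (fun w =>
          (∃ z, (w, z) ∈ E₂₃) ∧ σ₂ r ≤ σ₂ w ∧ σ₂ w < σ₂ g.1)).card : ℝ)
        ≤ 2 * Real.sqrt k := by
  obtain ⟨g, hg, hmin⟩ := Finset.exists_min_image
    (E₂₃.filter (fun e => σ₂ r ≤ σ₂ e.1 ∧
      ((E₂₃.filter (fun f => Cross2 σ₂ σ₃ e f)).card : ℝ) ≤ Real.sqrt k))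
    (fun e => σ₂ e.1) ⟨e₀, Finset.mem_filter.2 ⟨he₀, hre₀, hblue₀⟩⟩
  obtain ⟨hgE, hrg, hgk⟩ := Finset.mem_filter.1 hg
  refine ⟨g, hgE, hrg, hgk, ?_⟩
  set W := (Finset.univ : Finset V₂).filter (fun w =>
    (∃ z, (w, z) ∈ E₂₃) ∧ σ₂ r ≤ σ₂ w ∧ σ₂ w < σ₂ g.1)
  have hedge : ∀ w : V₂, ∃ e : V₂ × V₃, w ∈ W → e ∈ E₂₃ ∧ e.1 = w := by
    intro w
    by_cases hw : w ∈ W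
    · obtain ⟨z, hz⟩ := (Finset.mem_filter.1 hw).2.1
      exact ⟨(w, z), fun _ => ⟨hz, rfl⟩⟩
    · exact ⟨e₀, fun h => absurd h hw⟩
  choose φ hφ using hedge
  have hinj : Set.InjOn φ W := fun a ha b hb hab => by
    rw [← (hφ a ha).2, ← (hφ b hb).2, hab]
  have hmany : ∀ w ∈ W,
      Real.sqrt k ≤ ((E₂₃.filter (fun f => Cross2 σ₂ σ₃ (φ w) f)).card : ℝ) := by
    intro w hw
    by_contra! hlt
    obtain ⟨-, -, hrw, hwg⟩ := Finset.mem_filter.1 hw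
    obtain ⟨hφE, hφw⟩ := hφ w hw
    have hle := hmin (φ w) (Finset.mem_filter.2 ⟨hφE, by rwa [hφw], hlt.le⟩)
    rw [hφw] at hle
    exact absurd hwg hle.not_gt
  have hsum : ∑ w ∈ W, (E₂₃.filter (fun f => Cross2 σ₂ σ₃ (φ w) f)).card ≤ 2 * k := by
    calc ∑ w ∈ W, (E₂₃.filter (fun f => Cross2 σ₂ σ₃ (φ w) f)).card
        = ∑ e ∈ W.image φ, (E₂₃.filter (fun f => Cross2 σ₂ σ₃ e f)).card :=
          (Finset.sum_image
            (f := fun e => (E₂₃.filter (fun f => Cross2 σ₂ σ₃ e f)).card) hinj).symm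
      _ ≤ ∑ e ∈ E₂₃, (E₂₃.filter (fun f => Cross2 σ₂ σ₃ e f)).card :=
          Finset.sum_le_sum_of_subset
            (Finset.image_subset_iff.2 fun w hw => (hφ w hw).1)
      _ ≤ 2 * crossNum E₂₃ σ₂ σ₃ := sum_card_filter_cross2_le _ _ _
      _ ≤ 2 * k := by omega
  have hmul : (W.card : ℝ) * Real.sqrt k ≤ 2 * k := by
    calc (W.card : ℝ) * Real.sqrt k = ∑ _w ∈ W, Real.sqrt k := by
          rw [Finset.sum_const, nsmul_eq_mul]
      _ ≤ ∑ w ∈ W, ((E₂₃.filter (fun f => Cross2 σ₂ σ₃ (φ w) f)).card : ℝ) :=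
          Finset.sum_le_sum hmany
      _ ≤ 2 * k := by exact_mod_cast hsum
  have hpos : 0 < Real.sqrt k := Real.sqrt_pos.2 (by exact_mod_cast hk)
  refine le_of_mul_le_mul_right ?_ hpos
  rwa [mul_assoc, Real.mul_self_sqrt (Nat.cast_nonneg k)]
end
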